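/- Let G be a Garside group of finite type and x ∈ G. If x^α ∈ SC(x) and x^β ∈ SC(x) for elements α, β ∈ G, then x^{α∧β} ∈ SC(x). -/

import Mathlib

/-- A Garside structure of finite type on a group `G`: a submonoid `P` of positive
elements with `P ∩ P⁻¹ = {1}`, such that the prefix order `a ⪯ b ↔ a⁻¹ * b ∈ P` is a
lattice order (with meet `wedge` and join `vee`), together with a Garside element `Δ ∈ P`
whose set of prefixes (the simple elements) is finite and generates `G`, satisfying
`Δ⁻¹ P Δ = P`, and such that every nontrivial positive element has a finite norm. -/
structure GarsideStructure (G : Type*) [Group G] where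
  P : Set G
  one_mem : (1 : G) ∈ P
  mul_mem : ∀ {a b : G}, a ∈ P → b ∈ P → a * b ∈ P
  eq_one_of_mem_of_inv_mem : ∀ a : G, a ∈ P → a⁻¹ ∈ P → a = 1
  wedge : G → G → G
  vee : G → G → G
  wedge_le_left : ∀ a b : G, (wedge a b)⁻¹ * a ∈ P
  wedge_le_right : ∀ a b : G, (wedge a b)⁻¹ * b ∈ P
  le_wedge : ∀ a b c : G, c⁻¹ * a ∈ P → c⁻¹ * b ∈ P → c⁻¹ * wedge a b ∈ P
  le_vee_left : ∀ a b : G, a⁻¹ * vee a b ∈ P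
  le_vee_right : ∀ a b : G, b⁻¹ * vee a b ∈ P
  vee_le : ∀ a b c : G, a⁻¹ * c ∈ P → b⁻¹ * c ∈ P → (vee a b)⁻¹ * c ∈ P
  Δ : G
  Δ_mem : Δ ∈ P
  simples_finite : {s : G | s ∈ P ∧ s⁻¹ * Δ ∈ P}.Finite
  simples_generate : Subgroup.closure {s : G | s ∈ P ∧ s⁻¹ * Δ ∈ P} = (⊤ : Subgroup G)
  conj_Delta_mem : ∀ a : G, a ∈ P → Δ⁻¹ * a * Δ ∈ P
  mem_of_conj_Delta_mem : ∀ a : G, Δ⁻¹ * a * Δ ∈ P → a ∈ P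
  norm_bounded : ∀ x : G, x ∈ P → x ≠ 1 →
    ∃ n : ℕ, ∀ L : List G, (∀ a ∈ L, a ∈ P ∧ a ≠ 1) → L.prod = x → L.length ≤ n

namespace GarsideStructure

variable {G : Type*} [Group G] (gs : GarsideStructure G)

/-- The prefix order: `a ⪯ b`. -/
def pre (a b : G) : Prop := a⁻¹ * b ∈ gs.P

/-- The suffix order: `a ≽ b` (i.e. `b` is a suffix of `a`). -/
def rdvd (a b : G) : Prop := a * b⁻¹ ∈ gs.P

/-- Greatest common divisor with respect to the suffix order `≽` : `a ∧↰ b`. -/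
def rwedge (a b : G) : G := (gs.vee a⁻¹ b⁻¹)⁻¹

/-- Least common multiple with respect to the suffix order `≽` : `a ∨↰ b`. -/
def rvee (a b : G) : G := (gs.wedge a⁻¹ b⁻¹)⁻¹

/-- Simple elements: positive prefixes of `Δ`. -/
def simple (s : G) : Prop := s ∈ gs.P ∧ s⁻¹ * gs.Δ ∈ gs.P

/-- Atoms: nontrivial positive elements which cannot be decomposed in `P`. -/
def atom (a : G) : Prop := a ∈ gs.P ∧ a ≠ 1 ∧
  ∀ b c : G, b ∈ gs.P → c ∈ gs.P → a = b * c → b = 1 ∨ c = 1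

/-- `inf x` : the maximal integer `p` with `Δ^p ⪯ x`. -/
noncomputable def ginf (x : G) : ℤ := sSup {p : ℤ | gs.pre (gs.Δ ^ p) x}

/-- `sup x` : the minimal integer `p` with `x ⪯ Δ^p`. -/
noncomputable def gsup (x : G) : ℤ := sInf {p : ℤ | gs.pre x (gs.Δ ^ p)}

/-- Canonical length `ℓ(x) = sup(x) - inf(x)`. -/
noncomputable def glen (x : G) : ℤ := gs.gsup x - gs.ginf x

/-- `‖x‖` : the maximal number of factors in a decomposition of `x` as a product of
nontrivial positive elements. -/
noncomputable def gnorm (x : G) : ℕ :=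
  sSup {k : ℕ | ∃ L : List G, (∀ a ∈ L, a ∈ gs.P ∧ a ≠ 1) ∧ L.prod = x ∧ L.length = k}

/-- The summit infimum `inf_s(x)` : the maximum of `inf` over the conjugacy class of `x`. -/
noncomputable def ginfs (x : G) : ℤ :=
  sSup {p : ℤ | ∃ y : G, (∃ α : G, α⁻¹ * x * α = y) ∧ p = gs.ginf y}

/-- The summit supremum `sup_s(x)` : the minimum of `sup` over the conjugacy class of `x`. -/
noncomputable def gsups (x : G) : ℤ :=
  sInf {p : ℤ | ∃ y : G, (∃ α : G, α⁻¹ * x * α = y) ∧ p = gs.gsup y}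

/-- The preferred prefix `𝔭(x) = (xΔ^{-inf x}) ∧ (x⁻¹Δ^{sup x}) ∧ Δ`. -/
noncomputable def pp (x : G) : G :=
  gs.wedge (gs.wedge (x * gs.Δ ^ (-gs.ginf x)) (x⁻¹ * gs.Δ ^ gs.gsup x)) gs.Δ

/-- Cyclic (left) sliding `𝔰(x) = 𝔭(x)⁻¹ x 𝔭(x)`. -/
noncomputable def sl (x : G) : G := (gs.pp x)⁻¹ * x * gs.pp x

/-- The preferred suffix `𝔭↰(x) = (Δ^{-inf x}x) ∧↰ (Δ^{sup x}x⁻¹) ∧↰ Δ`. -/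
noncomputable def ps (x : G) : G :=
  gs.rwedge (gs.rwedge (gs.Δ ^ (-gs.ginf x) * x) (gs.Δ ^ gs.gsup x * x⁻¹)) gs.Δ

/-- Cyclic right sliding `𝔰↰(x) = 𝔭↰(x) x 𝔭↰(x)⁻¹`. -/
noncomputable def rsl (x : G) : G := gs.ps x * x * (gs.ps x)⁻¹

/-- The super summit set `SSS(x)` : conjugates of `x` with maximal infimum and minimal
supremum among all conjugates of `x`. -/
def SSS (x : G) : Set G :=
  {y | (∃ α : G, α⁻¹ * x * α = y) ∧
    ∀ z : G, (∃ α : G, α⁻¹ * x * α = z) → gs.ginf z ≤ gs.ginf y ∧ gs.gsup y ≤ gs.gsup z}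

/-- The set of sliding circuits `SC(x)` : conjugates `y` of `x` with `𝔰^m(y) = y` for
some `m ≥ 1`. -/
noncomputable def SC (x : G) : Set G :=
  {y | (∃ α : G, α⁻¹ * x * α = y) ∧ ∃ m : ℕ, 1 ≤ m ∧ (gs.sl)^[m] y = y}

/-- The transport `α^{(1)} = 𝔭(x)⁻¹ α 𝔭(x^α)` of `α` at `x`. -/
noncomputable def transport (x α : G) : G := (gs.pp x)⁻¹ * α * gs.pp (α⁻¹ * x * α)

/-- Iterated transport `α^{(i)}` of `α` at `x`: `α^{(0)} = α` and `α^{(i+1)}` is the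
transport of `α^{(i)}` at `𝔰^i(x)`. -/
noncomputable def transportIter (x α : G) : ℕ → G
  | 0 => α
  | i + 1 => gs.transport ((gs.sl)^[i] x) (transportIter x α i)

/-- `c` is the `⪯`-minimal element `c_s(y)` satisfying `s ⪯ c` and `y^c ∈ SC(x)`. -/
def IsMinSCConj (x y s c : G) : Prop :=
  gs.pre s c ∧ (c⁻¹ * y * c) ∈ gs.SC x ∧
    ∀ d : G, gs.pre s d → (d⁻¹ * y * d) ∈ gs.SC x → gs.pre c d

/-- `s` is an indecomposable conjugator starting at `u`: `u^s ∈ SC(x)`, `s ≠ 1` and there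
is no `t` with `1 ≺ t ≺ s` and `u^t ∈ SC(x)`. -/
def IsIndecomposableConjugator (x u s : G) : Prop :=
  (s⁻¹ * u * s) ∈ gs.SC x ∧ s ≠ 1 ∧
    ¬ ∃ t : G, (gs.pre 1 t ∧ t ≠ 1) ∧ (gs.pre t s ∧ t ≠ s) ∧ (t⁻¹ * u * t) ∈ gs.SC x

/-- `u` is the pullback of `s` at `y = 𝔰(z)` : the `⪯`-minimal positive element with
`z^u ∈ SSS(x)` and `s ⪯ u^{(1)}` (transport at `z`). -/
def IsPullback (x z s u : G) : Prop :=
  u ∈ gs.P ∧ (u⁻¹ * z * u) ∈ gs.SSS x ∧ gs.pre s (gs.transport z u) ∧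
    ∀ u' : G, u' ∈ gs.P → (u'⁻¹ * z * u') ∈ gs.SSS x → gs.pre s (gs.transport z u') →
      gs.pre u u'

/-- The pullback `s_{(1)}` of `s` at `y = 𝔰(z)`. -/
noncomputable def pullbackOne (x z s : G) : G :=
  @Classical.epsilon G ⟨1⟩ (fun u => gs.IsPullback x z s u)

/-- The `k`-fold pullback `s_{(k)}` of `s` at `y = 𝔰^k(z)` (an element at `z`):
`s_{(0)} = s` and `s_{(k+1)}` is the pullback at `𝔰(z)` (relative to `z`) of the `k`-fold
pullback of `s` at `𝔰^k(𝔰(z)) = y`. -/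
noncomputable def pullbackIter (x : G) : G → ℕ → G → G
  | _, 0, s => s
  | z, k + 1, s => gs.pullbackOne x z (pullbackIter x (gs.sl z) k s)

end GarsideStructure

open GarsideStructure

variable {G : Type*} [Group G]

/-- A monotone sequence with values in a finite set repeats at some pair of consecutive indices. -/
theorem exists_eq_succ_of_le_succ {L : Type*} [PartialOrder L] {u : ℕ → L}
    (hu : ∀ i, u i ≤ u (i + 1)) {s : Set L} (hs : s.Finite) (hus : ∀ i, u i ∈ s) :
    ∃ i, u i = u (i + 1) := by
  by_contra! h
  have hinj : Function.Injective u :=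
    (strictMono_nat_of_lt_succ fun i => lt_of_le_of_ne (hu i) (h i)).injective
  exact Set.infinite_range_of_injective hinj (hs.subset (Set.range_subset_iff.2 hus))

theorem exists_le_of_iterate_inf {L : Type*} [SemilatticeInf L]
    (hfin : ∀ a b : L, (Set.Icc a b).Finite) {ψ χ : L → L}
    (hψ : ∀ a b, ψ (a ⊓ b) = ψ a ⊓ ψ b) (hχ : ∀ a b, χ (a ⊓ b) = χ a ⊓ χ b)
    (hcomm : ∀ a, ψ (χ a) = χ (ψ a)) (hψχ : ∀ a, a ≤ ψ (χ a))
    {d e : L} (hd : d ≤ ψ d) (hde : d ≤ e) :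
    ∃ i : ℕ, (fun a => ψ a ⊓ χ a ⊓ a)^[i] e ≤ ψ ((fun a => ψ a ⊓ χ a ⊓ a)^[i] e) := by
  set F : L → L := fun a => ψ a ⊓ χ a ⊓ a with hF
  set C : L → L := fun a => ψ a ⊓ a with hC
  have ψmono : ∀ {a b}, a ≤ b → ψ a ≤ ψ b := fun {a b} h => by
    rw [← inf_eq_left, ← hψ, inf_eq_left.2 h]
  have χmono : ∀ {a b}, a ≤ b → χ a ≤ χ b := fun {a b} h => by
    rw [← inf_eq_left, ← hχ, inf_eq_left.2 h]
  have Cmono : ∀ {a b}, a ≤ b → C a ≤ C b := fun h => inf_le_inf (ψmono h) h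
  have FC : ∀ a, F a ≤ C a := fun a => inf_le_inf_right _ inf_le_left
  have Fle : ∀ a, F a ≤ a := fun a => inf_le_right
  have FCi : ∀ i, F^[i] e ≤ C^[i] e := by
    intro i
    induction i with
    | zero => exact le_rfl
    | succ i ih =>
      rw [Function.iterate_succ_apply', Function.iterate_succ_apply']
      exact (FC _).trans (Cmono ih)
  have key : ∀ j, C^[j + 1] e ⊓ χ (F^[j] e) ≤ F^[j + 1] e := by
    intro j
    induction j with
    | zero =>
      exact le_inf (le_inf (inf_le_left.trans inf_le_left) inf_le_right)
        (inf_le_left.trans inf_le_right)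
    | succ j ih =>
      have h1 : C^[j + 1 + 1] e ⊓ χ (F^[j + 1] e) ≤ C (F^[j + 1] e) := by
        refine le_trans ?_ (Cmono ih)
        have : C (C^[j + 1] e ⊓ χ (F^[j] e)) = C^[j + 1 + 1] e ⊓ χ (C (F^[j] e)) := by
          rw [Function.iterate_succ_apply' C (j + 1)]
          simp only [hC, hψ, hχ, hcomm]
          ac_rfl
        rw [this]
        refine inf_le_inf_left _ (χmono ?_)
        rw [Function.iterate_succ_apply']
        exact FC _
      rw [Function.iterate_succ_apply' F (j + 1)]
      exact le_inf (le_inf (h1.trans inf_le_left) inf_le_right) (h1.trans inf_le_right)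
  have hCd : ∀ i, d ≤ C^[i] e := by
    intro i
    induction i with
    | zero => exact hde
    | succ i ih =>
      rw [Function.iterate_succ_apply']
      exact le_inf (hd.trans (ψmono ih)) ih
  have hCsucc : ∀ i, C^[i + 1] e ≤ C^[i] e := fun i => by
    rw [Function.iterate_succ_apply']
    exact inf_le_right
  have hCe : ∀ i, C^[i] e ≤ e := by
    intro i
    induction i with
    | zero => exact le_rfl
    | succ i ih => exact (hCsucc i).trans ih
  obtain ⟨i, hi⟩ := exists_eq_succ_of_le_succ (L := Lᵒᵈ) (u := fun i => C^[i] e) hCsucc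
    (hfin d e) fun i => ⟨hCd i, hCe i⟩
  have hCψ : C^[i] e ≤ ψ (C^[i] e) := by
    have h : C^[i] e = C (C^[i] e) := by
      rw [← Function.iterate_succ_apply' C]
      exact hi
    exact h.le.trans inf_le_left
  refine ⟨i, ?_⟩
  cases i with
  | zero => exact hCψ
  | succ j =>
    refine le_trans ?_ (ψmono (key j))
    rw [hψ]
    refine le_inf ((FCi _).trans hCψ) (le_trans ?_ (hψχ _))
    rw [Function.iterate_succ_apply']
    exact Fle _

/-- The properties of a Garside element `Δ` of a group with a left-invariant lattice order. -/
structure IsGarsideElement [Lattice G] (Δ : G) : Prop where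
  one_le : 1 ≤ Δ
  mul_zpow_le : ∀ (n : ℤ) {a b : G}, a ≤ b → a * Δ ^ n ≤ b * Δ ^ n
  finite_Icc : ∀ a b : G, (Set.Icc a b).Finite
  exists_le_pow : ∀ a : G, ∃ n : ℕ, a ≤ Δ ^ n

/-- The map `a ↦ a * 𝔭(a⁻¹ * y * a)`, where `𝔭` is the preferred prefix formed with the fixed
exponents `p` and `q` in place of the infimum and the supremum. -/
def slideMap [Lattice G] (Δ y : G) (p q : ℤ) (a : G) : G :=
  y * a * Δ ^ (-p) ⊓ y⁻¹ * a * Δ ^ q ⊓ a * Δ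

namespace IsGarsideElement

variable [Lattice G] {Δ : G}

theorem mul_zpow_le_iff (h : IsGarsideElement Δ) (n : ℤ) {a b : G} :
    a * Δ ^ n ≤ b * Δ ^ n ↔ a ≤ b := by
  refine ⟨fun hab => ?_, h.mul_zpow_le n⟩
  simpa [mul_assoc] using h.mul_zpow_le (-n) hab

theorem inf_mul_zpow (h : IsGarsideElement Δ) (n : ℤ) (a b : G) :
    (a ⊓ b) * Δ ^ n = a * Δ ^ n ⊓ b * Δ ^ n := by
  refine le_antisymm (le_inf (h.mul_zpow_le n inf_le_left) (h.mul_zpow_le n inf_le_right)) ?_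
  rw [← h.mul_zpow_le_iff (-n), zpow_neg, mul_inv_cancel_right]
  refine le_inf ?_ ?_
  · simpa using
      h.mul_zpow_le (-n) (inf_le_left : a * Δ ^ n ⊓ b * Δ ^ n ≤ a * Δ ^ n)
  · simpa using
      h.mul_zpow_le (-n) (inf_le_right : a * Δ ^ n ⊓ b * Δ ^ n ≤ b * Δ ^ n)

theorem slideMap_inv (y : G) (p q : ℤ) : slideMap Δ y⁻¹ (-q) (-p) = slideMap Δ y p q := by
  funext a
  simp only [slideMap, neg_neg, inv_inv]
  rw [inf_comm (y * a * Δ ^ (-p))]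

theorem slideMap_mul_zpow (h : IsGarsideElement Δ) (y : G) (p q : ℤ) (a : G) (n : ℤ) :
    slideMap Δ y p q (a * Δ ^ n) = slideMap Δ y p q a * Δ ^ n := by
  have h1 : Δ ^ n * Δ = Δ * Δ ^ n := ((Commute.refl Δ).zpow_left n).eq
  have h2 : Δ ^ n * Δ ^ (-p) = Δ ^ (-p) * Δ ^ n := (Commute.zpow_zpow_self Δ n (-p)).eq
  have h3 : Δ ^ n * Δ ^ q = Δ ^ q * Δ ^ n := (Commute.zpow_zpow_self Δ n q).eq
  simp only [slideMap, h.inf_mul_zpow, mul_assoc, h1, h2, h3]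

theorem iterate_slideMap_mul_zpow (h : IsGarsideElement Δ) (y : G) (p q : ℤ) (i : ℕ) (a : G)
    (n : ℤ) :
    (slideMap Δ y p q)^[i] (a * Δ ^ n) = (slideMap Δ y p q)^[i] a * Δ ^ n := by
  induction i generalizing a with
  | zero => rfl
  | succ i ih => simp only [Function.iterate_succ_apply, h.slideMap_mul_zpow, ih]

variable [MulLeftMono G]

theorem zpow_le_zpow (h : IsGarsideElement Δ) {m n : ℤ} (hmn : m ≤ n) : Δ ^ m ≤ Δ ^ n := by
  obtain ⟨k, rfl⟩ := Int.le.dest hmn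
  rw [zpow_add, zpow_natCast]
  refine le_mul_of_one_le_right' ?_
  exact one_le_pow_of_one_le' h.one_le k

theorem zpow_le_inv_iff (h : IsGarsideElement Δ) (n : ℤ) (a : G) :
    Δ ^ n ≤ a⁻¹ ↔ a ≤ Δ ^ (-n) := by
  rw [← h.mul_zpow_le_iff (-n), ← mul_le_mul_iff_left a]
  simp

theorem exists_zpow_neg_le (h : IsGarsideElement Δ) (a : G) : ∃ n : ℕ, Δ ^ (-(n : ℤ)) ≤ a := by
  obtain ⟨n, hn⟩ := h.exists_le_pow a⁻¹
  refine ⟨n, ?_⟩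
  have := (h.zpow_le_inv_iff (-(n : ℤ)) a⁻¹).2 (by simpa using hn)
  simpa using this

theorem zpow_le_conj_iff (a y : G) (r : ℤ) : Δ ^ r ≤ a⁻¹ * y * a ↔ a * Δ ^ r ≤ y * a := by
  rw [← mul_le_mul_iff_left a]
  simp [mul_assoc]

theorem conj_le_zpow_iff (a y : G) (r : ℤ) : a⁻¹ * y * a ≤ Δ ^ r ↔ y * a ≤ a * Δ ^ r := by
  rw [← mul_le_mul_iff_left a]
  simp [mul_assoc]

section slideMap

variable (y : G) (p q : ℤ)

theorem slideMap_inf (h : IsGarsideElement Δ) (a b : G) :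
    slideMap Δ y p q (a ⊓ b) = slideMap Δ y p q a ⊓ slideMap Δ y p q b := by
  have h1 := h.inf_mul_zpow 1 a b
  rw [zpow_one] at h1
  simp only [slideMap, mul_inf, h.inf_mul_zpow, h1]
  ac_rfl

theorem slideMap_mono (h : IsGarsideElement Δ) : Monotone (slideMap Δ y p q) := fun a b hab => by
  rw [← inf_eq_left, ← h.slideMap_inf, inf_eq_left.2 hab]

theorem slideMap_commute {y c : G} (hc : Commute c y) (a : G) :
    slideMap Δ y p q (c * a) = c * slideMap Δ y p q a := by
  simp only [slideMap, mul_inf, ← mul_assoc, hc.eq, hc.inv_right.eq]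

theorem iterate_slideMap_inf (h : IsGarsideElement Δ) (i : ℕ) (a b : G) :
    (slideMap Δ y p q)^[i] (a ⊓ b) = (slideMap Δ y p q)^[i] a ⊓ (slideMap Δ y p q)^[i] b := by
  induction i generalizing a b with
  | zero => rfl
  | succ i ih => simp only [Function.iterate_succ_apply, h.slideMap_inf, ih]

theorem iterate_slideMap_commute {y c : G} (hc : Commute c y) (i : ℕ) (a : G) :
    (slideMap Δ y p q)^[i] (c * a) = c * (slideMap Δ y p q)^[i] a := by
  induction i generalizing a with
  | zero => rfl
  | succ i ih => simp only [Function.iterate_succ_apply, slideMap_commute p q hc, ih]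

variable {y p q}

theorem zpow_le_conj_slideMap (h : IsGarsideElement Δ) {a : G} {r : ℤ}
    (ha : Δ ^ r ≤ a⁻¹ * y * a) :
    Δ ^ r ≤ (slideMap Δ y p q a)⁻¹ * y * slideMap Δ y p q a := by
  rw [zpow_le_conj_iff] at ha ⊢
  rw [← h.slideMap_mul_zpow, ← slideMap_commute p q (Commute.refl y)]
  exact h.slideMap_mono y p q ha

theorem conj_slideMap_le_zpow (h : IsGarsideElement Δ) {a : G} {r : ℤ}
    (ha : a⁻¹ * y * a ≤ Δ ^ r) :
    (slideMap Δ y p q a)⁻¹ * y * slideMap Δ y p q a ≤ Δ ^ r := by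
  rw [conj_le_zpow_iff] at ha ⊢
  rw [← h.slideMap_mul_zpow, ← slideMap_commute p q (Commute.refl y)]
  exact h.slideMap_mono y p q ha

/-- If `y ≤ Δ ^ r` has a conjugate above `Δ ^ r`, then `y` is above `Δ ^ r`. -/
theorem zpow_le_of_zpow_le_conj (h : IsGarsideElement Δ) {r : ℤ} (hy : y ≤ Δ ^ r) {d : G}
    (hd : Δ ^ r ≤ d⁻¹ * y * d) : Δ ^ r ≤ y := by
  rw [zpow_le_conj_iff] at hd
  obtain ⟨n, hn⟩ := h.exists_zpow_neg_le d
  set χ : G → G := fun a => y⁻¹ * a * Δ ^ r with hχ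
  set d' := d * Δ ^ (n : ℤ) with hd'
  have hχmono : Monotone χ := fun a b hab => h.mul_zpow_le r (mul_le_mul_right hab _)
  have hχinj : Function.Injective χ := fun a b hab => by simpa [hχ] using hab
  have h1 : 1 ≤ χ 1 := by
    simpa [hχ] using mul_le_mul_right hy y⁻¹
  have hd1 : 1 ≤ d' := by simpa [hd'] using h.mul_zpow_le (n : ℤ) hn
  have hχd : χ d' ≤ d' := by
    have := h.mul_zpow_le (n : ℤ) (mul_le_mul_right hd y⁻¹)
    rw [mul_assoc, mul_assoc d, (Commute.zpow_zpow_self Δ r (n : ℤ)).eq,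
      inv_mul_cancel_left] at this
    simpa only [hχ, hd', mul_assoc] using this
  have hsucc : ∀ i, χ^[i] 1 ≤ χ^[i + 1] 1 := fun i => by
    rw [Function.iterate_succ_apply]
    exact hχmono.iterate i h1
  have hle : ∀ i, χ^[i] 1 ≤ d' := by
    intro i
    induction i with
    | zero => exact hd1
    | succ i ih =>
      rw [Function.iterate_succ_apply']
      exact (hχmono ih).trans hχd
  have hge : ∀ i, 1 ≤ χ^[i] 1 := by
    intro i
    induction i with
    | zero => exact le_rfl
    | succ i ih => exact ih.trans (hsucc i)
  obtain ⟨i, hi⟩ := exists_eq_succ_of_le_succ hsucc (h.finite_Icc 1 d') fun i => ⟨hge i, hle i⟩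
  rw [Function.iterate_succ_apply] at hi
  have h2 : 1 = χ 1 := hχinj.iterate i hi
  have h3 : y⁻¹ * Δ ^ r = 1 := by simpa [hχ] using h2.symm
  rw [inv_mul_eq_one] at h3
  exact h3.ge

/-- Iterated sliding increases the infimum whenever some conjugate has larger infimum. -/
theorem exists_zpow_le_conj_iterate (h : IsGarsideElement Δ) (hy : y ≤ Δ ^ q) {d : G}
    (hd : Δ ^ (p + 1) ≤ d⁻¹ * y * d) :
    ∃ i : ℕ, Δ ^ (p + 1) ≤
      ((slideMap Δ y p q)^[i] 1)⁻¹ * y * (slideMap Δ y p q)^[i] 1 := by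
  rcases le_or_gt q (p + 1) with hq | hq
  · exact ⟨0, by simpa using h.zpow_le_of_zpow_le_conj (hy.trans (h.zpow_le_zpow hq)) hd⟩
  rw [zpow_le_conj_iff] at hd
  obtain ⟨n, hn⟩ := h.exists_le_pow d
  set ψ : G → G := fun a => y * a * Δ ^ (-(p + 1)) with hψ
  set χ : G → G := fun a => y⁻¹ * a * Δ ^ (q - 1) with hχ
  have hψ_le : ∀ a, a ≤ ψ a ↔ a * Δ ^ (p + 1) ≤ y * a := fun a => by
    rw [← h.mul_zpow_le_iff (p + 1)]
    simp only [hψ, mul_assoc, zpow_neg, inv_mul_cancel, mul_one]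
  obtain ⟨i, hi⟩ := exists_le_of_iterate_inf h.finite_Icc (ψ := ψ) (χ := χ)
    (d := d * Δ ^ (-(n : ℤ))) (e := 1)
    (fun a b => by simp only [hψ, mul_inf, h.inf_mul_zpow])
    (fun a b => by simp only [hχ, mul_inf, h.inf_mul_zpow])
    (fun a => by
      simp [hψ, hχ, mul_assoc, (Commute.zpow_zpow_self Δ (q - 1) (-(p + 1))).eq, -zpow_neg, -neg_add_rev])
    (fun a => by
      have : ψ (χ a) = a * Δ ^ (q - 1 + -(p + 1)) := by
        simp [hψ, hχ, mul_assoc, zpow_add, -zpow_neg, -neg_add_rev]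
      rw [this]
      refine le_mul_of_one_le_right' ?_
      simpa using h.zpow_le_zpow (m := 0) (n := q - 1 + -(p + 1)) (by lia))
    (by
      rw [hψ_le]
      have := h.mul_zpow_le (-(n : ℤ)) hd
      rwa [mul_assoc, (Commute.zpow_zpow_self Δ (p + 1) (-(n : ℤ))).eq, ← mul_assoc,
        mul_assoc y] at this)
    (by
      have := h.mul_zpow_le (-(n : ℤ)) hn
      simpa using this)
  have hF : (fun a => ψ a ⊓ χ a ⊓ a) = fun a => slideMap Δ y p q a * Δ ^ (-1 : ℤ) := by
    funext a
    simp only [slideMap, h.inf_mul_zpow, hψ, hχ, mul_assoc, ← zpow_add, ← zpow_one_add]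
    congr 2
    · congr 4
      lia
    · simp
  have hiter : ∀ j : ℕ, (fun a => ψ a ⊓ χ a ⊓ a)^[j] 1 =
      (slideMap Δ y p q)^[j] 1 * Δ ^ (-(j : ℤ)) := by
    intro j
    induction j with
    | zero => simp
    | succ j ih =>
      rw [hF] at ih ⊢
      rw [Function.iterate_succ_apply', ih, Function.iterate_succ_apply']
      simp only [h.slideMap_mul_zpow, mul_assoc, ← zpow_add]
      congr 2
      push_cast
      ring
  refine ⟨i, ?_⟩
  rw [zpow_le_conj_iff, ← h.mul_zpow_le_iff (-(i : ℤ)), mul_assoc,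
    (Commute.zpow_zpow_self Δ (p + 1) (-(i : ℤ))).eq, ← mul_assoc, mul_assoc y, ← hiter,
    ← hψ_le]
  exact hi

/-- Iterated sliding decreases the supremum whenever some conjugate has smaller supremum. -/
theorem exists_conj_iterate_le_zpow (h : IsGarsideElement Δ) (hy : Δ ^ p ≤ y) {d : G}
    (hd : d⁻¹ * y * d ≤ Δ ^ (q - 1)) :
    ∃ i : ℕ, ((slideMap Δ y p q)^[i] 1)⁻¹ * y * (slideMap Δ y p q)^[i] 1 ≤ Δ ^ (q - 1) := by
  have hconj : ∀ a : G, Δ ^ (-q + 1) ≤ a⁻¹ * y⁻¹ * a ↔ a⁻¹ * y * a ≤ Δ ^ (q - 1) := fun a => by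
    have := h.zpow_le_inv_iff (-q + 1) (a⁻¹ * y * a)
    rwa [show (a⁻¹ * y * a)⁻¹ = a⁻¹ * y⁻¹ * a by group, show -(-q + 1) = q - 1 by ring] at this
  obtain ⟨i, hi⟩ := h.exists_zpow_le_conj_iterate (y := y⁻¹) (p := -q) (q := -p) (d := d)
    (by rw [← h.zpow_le_inv_iff]; simpa using hy) ((hconj d).2 hd)
  rw [slideMap_inv] at hi
  exact ⟨i, (hconj _).1 hi⟩

/-- If the conjugates of `y` by `1` and by `d` both return to themselves after `N` slidings, then
the conjugate by `1 ⊓ d` returns to itself after some positive number of slidings. -/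
theorem exists_conj_iterate_inf_eq (h : IsGarsideElement Δ) {N : ℕ} (hN : 1 ≤ N) {d : G}
    (hy : Commute ((slideMap Δ y p q)^[N] 1) y)
    (hd : Commute ((slideMap Δ y p q)^[N] d * d⁻¹) y) :
    ∃ M : ℕ, 1 ≤ M ∧
      ((slideMap Δ y p q)^[M] (1 ⊓ d))⁻¹ * y * (slideMap Δ y p q)^[M] (1 ⊓ d) =
        (1 ⊓ d)⁻¹ * y * (1 ⊓ d) := by
  set F := slideMap Δ y p q with hF
  set g := F^[N] 1 with hg
  set c := F^[N] d * d⁻¹ with hc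
  have hpow : ∀ {e b : G}, Commute b y → F^[N] e = b * e → ∀ k : ℕ, F^[k * N] e = b ^ k * e := by
    intro e b hb he k
    induction k with
    | zero => simp
    | succ k ih =>
      rw [Nat.succ_mul, Nat.add_comm, Function.iterate_add_apply, ih,
        iterate_slideMap_commute p q (hb.pow_left k), he, pow_succ, mul_assoc]
  have hg' : ∀ k : ℕ, F^[k * N] 1 = g ^ k := fun k => by
    rw [hpow hy (by rw [mul_one]) k, mul_one]
  have hc' : ∀ k : ℕ, F^[k * N] d = c ^ k * d := hpow hd (by simp [hc])
  obtain ⟨m, hm⟩ := h.exists_zpow_neg_le d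
  obtain ⟨n, hn⟩ := h.exists_le_pow d
  have hmem : ∀ k : ℕ, (g ^ k)⁻¹ * (c ^ k * d) ∈ Set.Icc (Δ ^ (-(m : ℤ))) (Δ ^ (n : ℤ)) := by
    intro k
    have hmono : Monotone F^[k * N] := (h.slideMap_mono y p q).iterate _
    rw [← zpow_natCast] at hn
    have hm' := hmono hm
    have hn' := hmono hn
    rw [← one_mul (Δ ^ _), h.iterate_slideMap_mul_zpow, ← hF, hg', hc'] at hm' hn'
    constructor
    · rw [← mul_le_mul_iff_left (g ^ k)]
      simpa using hm'
    · rw [← mul_le_mul_iff_left (g ^ k)]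
      simpa using hn'
  have hpigeon : ∃ k l : ℕ, k < l ∧ (g ^ k)⁻¹ * (c ^ k * d) = (g ^ l)⁻¹ * (c ^ l * d) := by
    by_contra! hne
    have hinj : Function.Injective fun k : ℕ => (g ^ k)⁻¹ * (c ^ k * d) := by
      intro k l hkl
      rcases lt_trichotomy k l with hlt | heq | hlt
      · exact absurd hkl (hne k l hlt)
      · exact heq
      · exact absurd hkl.symm (hne l k hlt)
    exact Set.infinite_range_of_injective hinj
      ((h.finite_Icc _ _).subset (Set.range_subset_iff.2 hmem))
  obtain ⟨k, l, hkl, heq⟩ := hpigeon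
  obtain ⟨j, rfl⟩ := Nat.exists_eq_add_of_lt hkl
  have hgc : g ^ (j + 1) = c ^ (j + 1) := by
    rw [← mul_assoc, ← mul_assoc, mul_left_inj, add_assoc, add_comm k, pow_add, pow_add c,
      mul_inv_rev, mul_assoc, mul_right_inj, ← mul_assoc, right_eq_mul, inv_mul_eq_one] at heq
    exact heq
  refine ⟨(j + 1) * N, Nat.mul_pos j.succ_pos hN, ?_⟩
  have hgy : Commute (g ^ (j + 1)) y := hy.pow_left _
  have : F^[(j + 1) * N] (1 ⊓ d) = g ^ (j + 1) * (1 ⊓ d) := by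
    rw [h.iterate_slideMap_inf, ← hF, hg', hc', hgc, mul_inf, mul_one]
  rw [this, mul_inv_rev]
  have h2 : (g ^ (j + 1))⁻¹ * y * g ^ (j + 1) = y := by
    rw [mul_assoc, ← hgy.eq, inv_mul_cancel_left]
  calc _ = (1 ⊓ d)⁻¹ * ((g ^ (j + 1))⁻¹ * y * g ^ (j + 1)) * (1 ⊓ d) := by group
    _ = _ := by rw [h2]

end slideMap

end IsGarsideElement

namespace GarsideStructure

variable (gs : GarsideStructure G)

/-- The prefix order of a Garside structure, as a lattice. -/
@[reducible]
def lattice : Lattice G where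
  le := gs.pre
  le_refl a := by
    change a⁻¹ * a ∈ gs.P
    rw [inv_mul_cancel]
    exact gs.one_mem
  le_trans a b c hab hbc := by
    have := gs.mul_mem hab hbc
    change a⁻¹ * c ∈ gs.P
    rwa [show a⁻¹ * b * (b⁻¹ * c) = a⁻¹ * c by group] at this
  le_antisymm a b hab hba := by
    refine inv_mul_eq_one.1 (gs.eq_one_of_mem_of_inv_mem (a⁻¹ * b) hab ?_)
    rwa [mul_inv_rev, inv_inv]
  inf := gs.wedge
  inf_le_left := gs.wedge_le_left
  inf_le_right := gs.wedge_le_right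
  le_inf a b c := gs.le_wedge b c a
  sup := gs.vee
  le_sup_left := gs.le_vee_left
  le_sup_right := gs.le_vee_right
  sup_le a b c := gs.vee_le a b c

theorem mulLeftMono_lattice : letI := gs.lattice; MulLeftMono G := by
  let _ := gs.lattice
  refine ⟨fun a b c hbc => ?_⟩
  change (a * b)⁻¹ * (a * c) ∈ gs.P
  rwa [show (a * b)⁻¹ * (a * c) = b⁻¹ * c by group]

theorem conj_zpow_mem (n : ℤ) {a : G} (ha : a ∈ gs.P) : (gs.Δ ^ n)⁻¹ * a * gs.Δ ^ n ∈ gs.P := by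
  induction n with
  | zero => simpa using ha
  | succ n ih =>
    have := gs.conj_Delta_mem _ ih
    rwa [show gs.Δ⁻¹ * ((gs.Δ ^ (n : ℤ))⁻¹ * a * gs.Δ ^ (n : ℤ)) * gs.Δ =
      (gs.Δ ^ ((n : ℤ) + 1))⁻¹ * a * gs.Δ ^ ((n : ℤ) + 1) by group] at this
  | pred n ih =>
    refine gs.mem_of_conj_Delta_mem _ ?_
    rwa [show gs.Δ⁻¹ * ((gs.Δ ^ (-(n : ℤ) - 1))⁻¹ * a * gs.Δ ^ (-(n : ℤ) - 1)) * gs.Δ =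
      (gs.Δ ^ (-(n : ℤ)))⁻¹ * a * gs.Δ ^ (-(n : ℤ)) by group]

theorem pow_mem (n : ℕ) : gs.Δ ^ n ∈ gs.P := by
  induction n with
  | zero => simpa using gs.one_mem
  | succ n ih =>
    rw [pow_succ]
    exact gs.mul_mem ih gs.Δ_mem

theorem pre_mul_zpow (n : ℤ) {a b : G} (hab : gs.pre a b) :
    gs.pre (a * gs.Δ ^ n) (b * gs.Δ ^ n) := by
  have := gs.conj_zpow_mem n hab
  rwa [show (gs.Δ ^ n)⁻¹ * (a⁻¹ * b) * gs.Δ ^ n = (a * gs.Δ ^ n)⁻¹ * (b * gs.Δ ^ n) by group]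
    at this

theorem exists_pre_pow (a : G) : ∃ n : ℕ, gs.pre a (gs.Δ ^ n) := by
  let _ := gs.lattice
  have := gs.mulLeftMono_lattice
  suffices h : ∀ x : G, ∃ n : ℕ, x ≤ gs.Δ ^ n ∧ x⁻¹ ≤ gs.Δ ^ n by
    obtain ⟨n, hn, -⟩ := h a
    exact ⟨n, hn⟩
  have hone : ∀ n : ℕ, 1 ≤ gs.Δ ^ n := fun n => by
    change 1⁻¹ * gs.Δ ^ n ∈ gs.P
    rw [inv_one, one_mul]
    exact gs.pow_mem n
  have hmul : ∀ {x y : G} {m n : ℕ}, x ≤ gs.Δ ^ m → y ≤ gs.Δ ^ n → x * y ≤ gs.Δ ^ (m + n) := by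
    intro x y m n hx hy
    refine (mul_le_mul_right hy x).trans ?_
    have := gs.pre_mul_zpow (n : ℤ) hx
    rwa [zpow_natCast, ← pow_add] at this
  intro x
  have hx : x ∈ Subgroup.closure {s : G | s ∈ gs.P ∧ s⁻¹ * gs.Δ ∈ gs.P} := by
    rw [gs.simples_generate]
    trivial
  induction hx using Subgroup.closure_induction with
  | mem s hs =>
    refine ⟨1, by rw [pow_one]; exact hs.2, le_trans ?_ (hone 1)⟩
    change s⁻¹⁻¹ * 1 ∈ gs.P
    rw [inv_inv, mul_one]
    exact hs.1
  | one => exact ⟨0, by simp⟩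
  | mul x y _ _ ihx ihy =>
    obtain ⟨m, hm, hm'⟩ := ihx
    obtain ⟨n, hn, hn'⟩ := ihy
    refine ⟨m + n, hmul hm hn, ?_⟩
    rw [mul_inv_rev, add_comm]
    exact hmul hn' hm'
  | inv x _ ih =>
    obtain ⟨n, hn, hn'⟩ := ih
    exact ⟨n, hn', by rwa [inv_inv]⟩

theorem finite_pre_pow (n : ℕ) : {a : G | a ∈ gs.P ∧ gs.pre a (gs.Δ ^ n)}.Finite := by
  induction n with
  | zero =>
    refine (Set.finite_singleton (1 : G)).subset fun a ha => ?_
    refine gs.eq_one_of_mem_of_inv_mem a ha.1 ?_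
    simpa [pre] using ha.2
  | succ n ih =>
    refine (Set.Finite.image2 (· * ·) gs.simples_finite ih).subset fun a ha => ?_
    have h1 : gs.wedge a gs.Δ ∈ gs.P := by
      have := gs.le_wedge a gs.Δ 1 (by simpa using ha.1) (by simpa using gs.Δ_mem)
      simpa using this
    refine ⟨gs.wedge a gs.Δ, ⟨h1, gs.wedge_le_right _ _⟩, (gs.wedge a gs.Δ)⁻¹ * a,
      ⟨gs.wedge_le_left _ _, ?_⟩, by simp⟩
    have h2 : gs.pre (a * gs.Δ ^ (-(n : ℤ))) a := by
      have := gs.conj_zpow_mem (-(n : ℤ)) (gs.pow_mem n)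
      rw [pre]
      convert this using 1
      group
    have h3 : gs.pre (a * gs.Δ ^ (-(n : ℤ))) gs.Δ := by
      have := gs.pre_mul_zpow (-(n : ℤ)) ha.2
      rwa [pow_succ', zpow_neg gs.Δ, zpow_natCast, mul_inv_cancel_right, ← zpow_natCast,
        ← zpow_neg] at this
    have h4 := gs.pre_mul_zpow n (gs.le_wedge _ _ _ h2 h3)
    rw [zpow_neg, inv_mul_cancel_right, zpow_natCast] at h4
    change ((gs.wedge a gs.Δ)⁻¹ * a)⁻¹ * gs.Δ ^ n ∈ gs.P
    rw [pre] at h4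
    convert h4 using 1
    group

theorem isGarsideElement : letI := gs.lattice; IsGarsideElement gs.Δ := by
  let _ := gs.lattice
  have := gs.mulLeftMono_lattice
  refine ⟨?_, gs.pre_mul_zpow, fun a b => ?_, gs.exists_pre_pow⟩
  · change 1⁻¹ * gs.Δ ∈ gs.P
    rw [inv_one, one_mul]
    exact gs.Δ_mem
  · obtain ⟨n, hn⟩ := gs.exists_pre_pow (a⁻¹ * b)
    refine ((gs.finite_pre_pow n).image (a * ·)).subset fun c hc => ?_
    refine ⟨a⁻¹ * c, ⟨hc.1, ?_⟩, by simp⟩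
    exact le_trans (mul_le_mul_right hc.2 a⁻¹) hn

theorem le_of_zpow_pre_zpow (hΔ : gs.Δ ≠ 1) {m n : ℤ} (h : gs.pre (gs.Δ ^ m) (gs.Δ ^ n)) :
    m ≤ n := by
  by_contra! hlt
  obtain ⟨k, hk⟩ := Int.le.dest (Int.add_one_le_of_lt hlt)
  refine hΔ (gs.eq_one_of_mem_of_inv_mem _ gs.Δ_mem ?_)
  have := gs.mul_mem (gs.pow_mem k) h
  rw [← zpow_neg, ← zpow_natCast, ← zpow_add, ← zpow_add] at this
  rwa [show (k : ℤ) + (-m + n) = -1 by lia, zpow_neg_one] at this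

theorem zpow_pre_iff_le_ginf (hΔ : gs.Δ ≠ 1) (x : G) (r : ℤ) :
    gs.pre (gs.Δ ^ r) x ↔ r ≤ gs.ginf x := by
  let _ := gs.lattice
  have := gs.mulLeftMono_lattice
  have h := gs.isGarsideElement
  have hbdd : BddAbove {p : ℤ | gs.pre (gs.Δ ^ p) x} := by
    obtain ⟨n, hn⟩ := h.exists_le_pow x
    refine ⟨n, fun r hr => gs.le_of_zpow_pre_zpow hΔ ?_⟩
    rw [zpow_natCast]
    exact le_trans (show gs.Δ ^ r ≤ x from hr) hn
  refine ⟨fun hr => le_csSup hbdd hr, fun hr => ?_⟩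
  obtain ⟨n, hn⟩ := h.exists_zpow_neg_le x
  exact le_trans (h.zpow_le_zpow hr) (Int.csSup_mem ⟨_, hn⟩ hbdd)

theorem pre_zpow_iff_gsup_le (hΔ : gs.Δ ≠ 1) (x : G) (r : ℤ) :
    gs.pre x (gs.Δ ^ r) ↔ gs.gsup x ≤ r := by
  let _ := gs.lattice
  have := gs.mulLeftMono_lattice
  have h := gs.isGarsideElement
  have hbdd : BddBelow {p : ℤ | gs.pre x (gs.Δ ^ p)} := by
    obtain ⟨n, hn⟩ := h.exists_zpow_neg_le x
    exact ⟨-(n : ℤ), fun p hp => gs.le_of_zpow_pre_zpow hΔ (le_trans hn hp)⟩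
  refine ⟨fun hr => csInf_le hbdd hr, fun hr => ?_⟩
  obtain ⟨n, hn⟩ := h.exists_le_pow x
  rw [← zpow_natCast] at hn
  have hmem : gs.pre x (gs.Δ ^ gs.gsup x) := Int.csInf_mem ⟨_, hn⟩ hbdd
  exact le_trans hmem (h.zpow_le_zpow hr)

theorem sl_conj (y a : G) {p q : ℤ} (hp : gs.ginf (a⁻¹ * y * a) = p)
    (hq : gs.gsup (a⁻¹ * y * a) = q) :
    letI := gs.lattice
    gs.sl (a⁻¹ * y * a) =
      (slideMap gs.Δ y p q a)⁻¹ * y * slideMap gs.Δ y p q a := by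
  let _ := gs.lattice
  have := gs.mulLeftMono_lattice
  have hpp : gs.pp (a⁻¹ * y * a) = a⁻¹ * slideMap gs.Δ y p q a := by
    change (a⁻¹ * y * a) * gs.Δ ^ (-gs.ginf (a⁻¹ * y * a)) ⊓
      (a⁻¹ * y * a)⁻¹ * gs.Δ ^ gs.gsup (a⁻¹ * y * a) ⊓ gs.Δ = _
    rw [hp, hq]
    simp only [slideMap, mul_inf, mul_inv_rev, inv_inv, mul_assoc, inv_mul_cancel_left]
  rw [sl, hpp]
  group

theorem sl_eq_conj (x : G) :
    letI := gs.lattice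
    gs.sl x = (slideMap gs.Δ x (gs.ginf x) (gs.gsup x) 1)⁻¹ * x *
      slideMap gs.Δ x (gs.ginf x) (gs.gsup x) 1 := by
  simpa using gs.sl_conj x 1 (p := gs.ginf x) (q := gs.gsup x) (by simp) (by simp)

theorem ginf_le_ginf_sl (hΔ : gs.Δ ≠ 1) (x : G) : gs.ginf x ≤ gs.ginf (gs.sl x) := by
  let _ := gs.lattice
  have := gs.mulLeftMono_lattice
  rw [← gs.zpow_pre_iff_le_ginf hΔ, gs.sl_eq_conj]
  refine gs.isGarsideElement.zpow_le_conj_slideMap (a := 1) ?_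
  rw [inv_one, one_mul, mul_one]
  exact (gs.zpow_pre_iff_le_ginf hΔ x _).2 le_rfl

theorem gsup_sl_le_gsup (hΔ : gs.Δ ≠ 1) (x : G) : gs.gsup (gs.sl x) ≤ gs.gsup x := by
  let _ := gs.lattice
  have := gs.mulLeftMono_lattice
  rw [← gs.pre_zpow_iff_gsup_le hΔ, gs.sl_eq_conj]
  refine gs.isGarsideElement.conj_slideMap_le_zpow (a := 1) ?_
  rw [inv_one, one_mul, mul_one]
  exact (gs.pre_zpow_iff_gsup_le hΔ x _).2 le_rfl

theorem ginf_gsup_iterate_sl (hΔ : gs.Δ ≠ 1) {x : G} {m : ℕ} (hm : 1 ≤ m) (hx : gs.sl^[m] x = x)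
    (i : ℕ) : gs.ginf (gs.sl^[i] x) = gs.ginf x ∧ gs.gsup (gs.sl^[i] x) = gs.gsup x := by
  have hinf : Monotone fun j => gs.ginf (gs.sl^[j] x) := monotone_nat_of_le_succ fun j => by
    rw [Function.iterate_succ_apply']
    exact gs.ginf_le_ginf_sl hΔ _
  have hsup : Antitone fun j => gs.gsup (gs.sl^[j] x) := antitone_nat_of_succ_le fun j => by
    rw [Function.iterate_succ_apply']
    exact gs.gsup_sl_le_gsup hΔ _
  have him : i ≤ i * m := Nat.le_mul_of_pos_right i hm
  have hper : gs.sl^[i * m] x = x := (Function.IsPeriodicPt.const_mul hx i)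
  constructor
  · refine le_antisymm ?_ (hinf (Nat.zero_le i))
    simpa [hper] using hinf him
  · refine le_antisymm (hsup (Nat.zero_le i)) ?_
    simpa [hper] using hsup him

theorem iterate_sl_conj (y a : G) {p q : ℤ}
    (h : ∀ i, gs.ginf (gs.sl^[i] (a⁻¹ * y * a)) = p ∧ gs.gsup (gs.sl^[i] (a⁻¹ * y * a)) = q)
    (i : ℕ) :
    letI := gs.lattice
    gs.sl^[i] (a⁻¹ * y * a) =
      ((slideMap gs.Δ y p q)^[i] a)⁻¹ * y * (slideMap gs.Δ y p q)^[i] a := by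
  let _ := gs.lattice
  induction i with
  | zero => rfl
  | succ i ih =>
    rw [Function.iterate_succ_apply', Function.iterate_succ_apply', ih]
    have hi := h i
    rw [ih] at hi
    exact gs.sl_conj y _ hi.1 hi.2

/-- An element of a sliding circuit has maximal infimum and minimal supremum among its
conjugates. -/
theorem ginf_conj_le_and_gsup_le (hΔ : gs.Δ ≠ 1) {y : G} {m : ℕ} (hm : 1 ≤ m)
    (hy : gs.sl^[m] y = y) (d : G) :
    gs.ginf (d⁻¹ * y * d) ≤ gs.ginf y ∧ gs.gsup y ≤ gs.gsup (d⁻¹ * y * d) := by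
  let _ := gs.lattice
  have := gs.mulLeftMono_lattice
  have h := gs.isGarsideElement
  have hconst := gs.ginf_gsup_iterate_sl hΔ hm hy
  have hiter := gs.iterate_sl_conj y 1 (p := gs.ginf y) (q := gs.gsup y) (by simpa using hconst)
  rw [inv_one, one_mul, mul_one] at hiter
  constructor
  · by_contra! hlt
    obtain ⟨i, hi⟩ := h.exists_zpow_le_conj_iterate (p := gs.ginf y) (q := gs.gsup y) (d := d)
      ((gs.pre_zpow_iff_gsup_le hΔ y _).2 le_rfl)
      ((gs.zpow_pre_iff_le_ginf hΔ _ _).2 (Int.add_one_le_of_lt hlt))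
    rw [← hiter] at hi
    have := (gs.zpow_pre_iff_le_ginf hΔ _ _).1 hi
    rw [(hconst i).1] at this
    lia
  · by_contra! hlt
    obtain ⟨i, hi⟩ := h.exists_conj_iterate_le_zpow (p := gs.ginf y) (q := gs.gsup y) (d := d)
      ((gs.zpow_pre_iff_le_ginf hΔ y _).2 le_rfl)
      ((gs.pre_zpow_iff_gsup_le hΔ _ _).2 (Int.le_sub_one_of_lt hlt))
    rw [← hiter] at hi
    have := (gs.pre_zpow_iff_gsup_le hΔ _ _).1 hi
    rw [(hconst i).2] at this
    lia

theorem exists_iterate_sl_conj_wedge (hΔ : gs.Δ ≠ 1) {y d : G} {m n : ℕ} (hm : 1 ≤ m)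
    (hn : 1 ≤ n) (hy : gs.sl^[m] y = y) (hd : gs.sl^[n] (d⁻¹ * y * d) = d⁻¹ * y * d) :
    ∃ M : ℕ, 1 ≤ M ∧ gs.sl^[M] ((gs.wedge 1 d)⁻¹ * y * gs.wedge 1 d) =
      (gs.wedge 1 d)⁻¹ * y * gs.wedge 1 d := by
  let _ := gs.lattice
  have := gs.mulLeftMono_lattice
  have h := gs.isGarsideElement
  set p := gs.ginf y with hp
  set q := gs.gsup y with hq
  have hext := gs.ginf_conj_le_and_gsup_le hΔ hm hy
  have hpq : ∀ a : G, gs.pre (gs.Δ ^ p) (a⁻¹ * y * a) → gs.pre (a⁻¹ * y * a) (gs.Δ ^ q) →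
      ∀ i, gs.sl^[i] (a⁻¹ * y * a) =
        ((slideMap gs.Δ y p q)^[i] a)⁻¹ * y * (slideMap gs.Δ y p q)^[i] a := by
    intro a ha ha' i
    have heq : ∀ b : G, gs.pre (gs.Δ ^ p) (b⁻¹ * y * b) → gs.pre (b⁻¹ * y * b) (gs.Δ ^ q) →
        gs.ginf (b⁻¹ * y * b) = p ∧ gs.gsup (b⁻¹ * y * b) = q := fun b hb hb' =>
      ⟨le_antisymm (hext b).1 ((gs.zpow_pre_iff_le_ginf hΔ _ _).1 hb),
        le_antisymm ((gs.pre_zpow_iff_gsup_le hΔ _ _).1 hb') (hext b).2⟩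
    induction i generalizing a with
    | zero => rfl
    | succ i ih =>
      rw [Function.iterate_succ_apply, Function.iterate_succ_apply,
        gs.sl_conj y a (heq a ha ha').1 (heq a ha ha').2]
      exact ih _ (h.zpow_le_conj_slideMap ha) (h.conj_slideMap_le_zpow ha')
  have hy1 : gs.pre (gs.Δ ^ p) y := (gs.zpow_pre_iff_le_ginf hΔ _ _).2 le_rfl
  have hy2 : gs.pre y (gs.Δ ^ q) := (gs.pre_zpow_iff_gsup_le hΔ _ _).2 le_rfl
  have hyd := gs.ginf_conj_le_and_gsup_le hΔ hn hd d⁻¹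
  rw [show d⁻¹⁻¹ * (d⁻¹ * y * d) * d⁻¹ = y by group] at hyd
  have hd1 : gs.pre (gs.Δ ^ p) (d⁻¹ * y * d) := (gs.zpow_pre_iff_le_ginf hΔ _ _).2 hyd.1
  have hd2 : gs.pre (d⁻¹ * y * d) (gs.Δ ^ q) := (gs.pre_zpow_iff_gsup_le hΔ _ _).2 hyd.2
  have hy_iter := hpq 1 (by simpa using hy1) (by simpa using hy2) (m * n)
  have hd_iter := hpq d hd1 hd2 (m * n)
  rw [(Function.IsPeriodicPt.const_mul hd m : gs.sl^[m * n] (d⁻¹ * y * d) = _)] at hd_iter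
  rw [inv_one, one_mul, mul_one, (Function.IsPeriodicPt.mul_const hy n : gs.sl^[m * n] y = y)]
    at hy_iter
  set g := (slideMap gs.Δ y p q)^[m * n] 1 with hg
  set c := (slideMap gs.Δ y p q)^[m * n] d with hc
  obtain ⟨M, hM, hMeq⟩ := h.exists_conj_iterate_inf_eq (N := m * n) (Nat.mul_pos hm hn)
    (y := y) (p := p) (q := q) (d := d)
    (by
      rw [← hg]
      change g * y = y * g
      conv_lhs => rw [hy_iter]
      group)
    (by
      rw [← hc]
      change c * d⁻¹ * y = y * (c * d⁻¹)
      calc c * d⁻¹ * y = c * (d⁻¹ * y * d) * d⁻¹ := by group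
        _ = y * (c * d⁻¹) := by rw [hd_iter]; group)
  refine ⟨M, hM, ?_⟩
  refine (hpq (1 ⊓ d) ?_ ?_ M).trans hMeq
  · refine (IsGarsideElement.zpow_le_conj_iff (1 ⊓ d) y p).2 ?_
    rw [h.inf_mul_zpow, mul_inf]
    refine inf_le_inf ?_ ((IsGarsideElement.zpow_le_conj_iff d y p).1 hd1)
    rw [one_mul, mul_one]
    exact hy1
  · refine (IsGarsideElement.conj_le_zpow_iff (1 ⊓ d) y q).2 ?_
    rw [h.inf_mul_zpow, mul_inf]
    refine inf_le_inf ?_ ((IsGarsideElement.conj_le_zpow_iff d y q).1 hd2)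
    rw [one_mul, mul_one]
    exact hy2

theorem eq_one_of_Delta_eq_one (hΔ : gs.Δ = 1) (a : G) : a = 1 := by
  have ha : a ∈ Subgroup.closure {s : G | s ∈ gs.P ∧ s⁻¹ * gs.Δ ∈ gs.P} := by
    rw [gs.simples_generate]
    trivial
  have hle : Subgroup.closure {s : G | s ∈ gs.P ∧ s⁻¹ * gs.Δ ∈ gs.P} ≤ ⊥ := by
    rw [Subgroup.closure_le]
    intro s hs
    refine gs.eq_one_of_mem_of_inv_mem s hs.1 ?_
    simpa [hΔ] using hs.2
  exact Subgroup.mem_bot.1 (hle ha)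

end GarsideStructure

/-- Convexity of the set of sliding circuits: it is closed under `∧` of conjugating
elements. -/
theorem sc_gcd (gs : GarsideStructure G) (x α β : G)
    (hα : α⁻¹ * x * α ∈ gs.SC x) (hβ : β⁻¹ * x * β ∈ gs.SC x) :
    (gs.wedge α β)⁻¹ * x * gs.wedge α β ∈ gs.SC x := by
  by_cases hΔ : gs.Δ = 1
  · rwa [gs.eq_one_of_Delta_eq_one hΔ (gs.wedge α β), ← gs.eq_one_of_Delta_eq_one hΔ α]
  let _ := gs.lattice
  have := gs.mulLeftMono_lattice
  obtain ⟨-, m, hm, hy⟩ := hα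
  obtain ⟨-, n, hn, hd⟩ := hβ
  have hwedge : gs.wedge α β = α * gs.wedge 1 (α⁻¹ * β) := by
    change α ⊓ β = α * (1 ⊓ α⁻¹ * β)
    rw [mul_inf, mul_one, mul_inv_cancel_left]
  obtain ⟨M, hM, h⟩ := gs.exists_iterate_sl_conj_wedge hΔ (d := α⁻¹ * β) hm hn hy (by
    rwa [show (α⁻¹ * β)⁻¹ * (α⁻¹ * x * α) * (α⁻¹ * β) = β⁻¹ * x * β by group])
  refine ⟨⟨_, rfl⟩, M, hM, ?_⟩
  rw [hwedge, mul_inv_rev]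
  simpa only [mul_assoc] using h
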